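/- Let m ≥ 1, u ∈ ℝᵐ and t = |u|², and suppose α(t)φ(t) ≠ 0, α₁(t)·(α₁+α₃)(t) ≠ 0 and φ₁(t)·(φ₁+φ₃)(t) ≠ 0. Then the matrix μ((α₁+α₃)(t),(β₁+β₃)(t),u) is invertible and μ(α₁(t),β₁(t),u) − μ(α₂(t),β₂(t),u)·μ((α₁+α₃)(t),(β₁+β₃)(t),u)⁻¹·μ(α₂(t),β₂(t),u) = μ(ω₁,ω₂,u), where ω₁ = α(t)/(α₁+α₃)(t) and ω₂ = [(φ₁+φ₃)(t)·(β₁(t)(α₁+α₃)(t) − α₂(t)β₂(t) − β₂(t)φ₂(t)) + φ₂(t)²·(β₁+β₃)(t)]/((α₁+α₃)(t)·(φ₁+φ₃)(t)). -/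

import Mathlib

open Matrix

/-- The `m × m` real matrix with `(i,j)` entry `a·δᵢⱼ + b·uⁱuʲ`. -/
def mu {m : ℕ} (a b : ℝ) (u : Fin m → ℝ) : Matrix (Fin m) (Fin m) ℝ :=
  Matrix.of fun i j => a * (if i = j then (1 : ℝ) else 0) + b * u i * u j

theorem mu_mul_mu {m : ℕ} (a b c d : ℝ) (u : Fin m → ℝ) :
    mu a b u * mu c d u = mu (a * c) (a * d + b * c + (∑ i, u i ^ 2) * b * d) u := by
  ext i j
  have key : ∀ k, (a * (if i = k then (1 : ℝ) else 0) + b * u i * u k) *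
      (c * (if k = j then (1 : ℝ) else 0) + d * u k * u j) =
      (if i = k then a * (c * (if k = j then (1 : ℝ) else 0) + d * u k * u j) else 0) +
      (if k = j then b * u i * u k * c else 0) + b * d * u i * u j * u k ^ 2 := by
    intro k
    split_ifs <;> ring
  simp only [mu, Matrix.mul_apply, Matrix.of_apply, key, Finset.sum_add_distrib,
    Finset.sum_ite_eq, Finset.sum_ite_eq', Finset.mem_univ, if_true, ← Finset.mul_sum]
  ring

theorem mu_one_zero {m : ℕ} (u : Fin m → ℝ) : mu 1 0 u = 1 := by
  ext i j
  simp [mu, Matrix.one_apply]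

theorem mu_sub_mu {m : ℕ} (a b c d : ℝ) (u : Fin m → ℝ) :
    mu a b u - mu c d u = mu (a - c) (b - d) u := by
  ext i j
  simp only [mu, Matrix.sub_apply, Matrix.of_apply]
  ring

theorem mu_mul_mu_inv {m : ℕ} {a b : ℝ} {u : Fin m → ℝ} (ha : a ≠ 0)
    (hab : a + (∑ i, u i ^ 2) * b ≠ 0) :
    mu a b u * mu a⁻¹ (-b / (a * (a + (∑ i, u i ^ 2) * b))) u = 1 := by
  rw [mu_mul_mu, ← mu_one_zero u]
  generalize ∑ i, u i ^ 2 = s at hab ⊢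
  generalize hF : a + s * b = F at hab ⊢
  congr 1 <;> field_simp
  rw [← hF]
  ring

theorem stmt5 (m : ℕ) (hm : 1 ≤ m) (α₁ α₂ α₃ β₁ β₂ β₃ : ℝ → ℝ)
    (u : Fin m → ℝ) (t : ℝ) (ht : t = ∑ i, u i ^ 2)
    (φ₁ φ₂ φ₃ A Φ : ℝ)
    (hφ₁ : φ₁ = α₁ t + t * β₁ t) (hφ₂ : φ₂ = α₂ t + t * β₂ t)
    (hφ₃ : φ₃ = α₃ t + t * β₃ t)
    (hA : A = α₁ t * (α₁ t + α₃ t) - α₂ t ^ 2)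
    (hΦ : Φ = φ₁ * (φ₁ + φ₃) - φ₂ ^ 2)
    (h1 : A * Φ ≠ 0) (h2 : α₁ t * (α₁ t + α₃ t) ≠ 0)
    (h3 : φ₁ * (φ₁ + φ₃) ≠ 0)
    (om₁ om₂ : ℝ)
    (hom₁ : om₁ = A / (α₁ t + α₃ t))
    (hom₂ : om₂ = ((φ₁ + φ₃) * (β₁ t * (α₁ t + α₃ t) - α₂ t * β₂ t - β₂ t * φ₂)
        + φ₂ ^ 2 * (β₁ t + β₃ t)) / ((α₁ t + α₃ t) * (φ₁ + φ₃))) :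
    IsUnit (mu (α₁ t + α₃ t) (β₁ t + β₃ t) u) ∧
      mu (α₁ t) (β₁ t) u
          - mu (α₂ t) (β₂ t) u * (mu (α₁ t + α₃ t) (β₁ t + β₃ t) u)⁻¹
              * mu (α₂ t) (β₂ t) u
        = mu om₁ om₂ u := by
  have ha : α₁ t + α₃ t ≠ 0 := right_ne_zero_of_mul h2
  have hF : φ₁ + φ₃ ≠ 0 := right_ne_zero_of_mul h3
  have hF_eq : φ₁ + φ₃ = (α₁ t + α₃ t) + t * (β₁ t + β₃ t) := by
    rw [hφ₁, hφ₃]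
    ring
  have hinv := mu_mul_mu_inv (b := β₁ t + β₃ t) (u := u) ha (by rwa [← ht, ← hF_eq])
  refine ⟨.of_mul_eq_one _ hinv, ?_⟩
  rw [Matrix.inv_eq_right_inv hinv, mu_mul_mu, mu_mul_mu, mu_sub_mu, ← ht, ← hF_eq, hom₁, hom₂,
    hA, hφ₂]
  congr 1
  · field_simp
  · field_simp
    rw [hF_eq]
    ring
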